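/- arXiv:2012.05361 — 6 statements merged into one kernel-verified Lean document; each statement's English description precedes it below -/
import Mathlib

section
/- In the ski-rental problem, the cost of the break-even algorithm A(b) on every instance is at most (1 + max{p/b, b/p}) times the offline optimal cost; that is, for every integer x ≥ 1, ALG_b(x) ≤ (1 + max{p/b, b/p}) · min(x, p). Consequently the competitive ratio of A(b) is at most 1 + max{p/b, b/p}, i.e., its degradation factor with respect to the optimal 2-competitive algorithm A(p) is at most 1/2 + max{p/(2b), b/(2p)}. -/
/-- Cost of the break-even algorithm `A(b)` in the ski-rental problem with
purchase price `p`, on an instance with `x` skiing days: rent for the first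
`b` days, buy on day `b+1`. -/
noncomputable def skiALG (b p x : ℕ) : ℝ :=
  if x ≤ b then (x : ℝ) else (b : ℝ) + (p : ℝ)

theorem skiALG_le_mul_min {p b : ℕ} (hp : 0 < p) (hb : 0 < b) (x : ℕ) :
    skiALG b p x ≤ (1 + max ((p : ℝ) / (b : ℝ)) ((b : ℝ) / (p : ℝ))) * min (x : ℝ) (p : ℝ) := by
  have hp' : (0 : ℝ) < p := by exact_mod_cast hp
  have hb' : (0 : ℝ) < b := by exact_mod_cast hb
  have hx : (0 : ℝ) ≤ x := x.cast_nonneg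
  have buy_ratio : (b : ℝ) + p ≤ (1 + max ((p : ℝ) / b) ((b : ℝ) / p)) * p :=
    calc (b : ℝ) + p = (1 + (b : ℝ) / p) * p := by field_simp; ring
      _ ≤ _ := by gcongr; exact le_max_right _ _
  unfold skiALG
  split_ifs with hxb
  · have hxb' : (x : ℝ) ≤ b := by exact_mod_cast hxb
    rcases le_total (x : ℝ) p with h | h
    · rw [min_eq_left h]
      have hmax : 0 ≤ max ((p : ℝ) / b) ((b : ℝ) / p) := le_max_of_le_left (by positivity)
      exact le_mul_of_one_le_left hx (by linarith)
    · rw [min_eq_right h]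
      linarith
  · have hbx : (b : ℝ) ≤ x := by exact_mod_cast (not_le.mp hxb).le
    rcases le_total (x : ℝ) p with h | h
    · rw [min_eq_left h]
      calc (b : ℝ) + p = (1 + (p : ℝ) / b) * b := by field_simp
        _ ≤ _ := by gcongr; exact le_max_left _ _
    · rw [min_eq_right h]
      exact buy_ratio

theorem half_add_max_div_two_mul (p b : ℝ) :
    1 / 2 + max (p / (2 * b)) (b / (2 * p)) = (1 + max (p / b) (b / p)) / 2 := by
  rw [add_div, ← max_div_div_right zero_le_two, div_div, div_div, mul_comm b, mul_comm p]

/-- In the ski-rental problem, the cost of `A(b)` on every instance is at most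
`(1 + max (p/b) (b/p))` times the offline optimum `min x p`; consequently its
degradation factor with respect to the optimal 2-competitive algorithm `A(p)`
is at most `1/2 + max (p/(2b)) (b/(2p))`. -/
theorem ski_rental_competitive_ratio (p b : ℕ) (hp : 1 < p) (hb : 1 ≤ b) :
    (∀ x : ℕ, 1 ≤ x →
      skiALG b p x ≤ (1 + max ((p : ℝ) / (b : ℝ)) ((b : ℝ) / (p : ℝ))) * min (x : ℝ) (p : ℝ)) ∧
    (∀ x : ℕ, 1 ≤ x →
      skiALG b p x ≤ (1 / 2 + max ((p : ℝ) / (2 * (b : ℝ))) ((b : ℝ) / (2 * (p : ℝ)))) *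
        (2 * min (x : ℝ) (p : ℝ))) := by
  refine ⟨fun x _ => skiALG_le_mul_min (Nat.zero_lt_of_lt hp) hb x, fun x _ => ?_⟩
  rw [half_add_max_div_two_mul, ← mul_assoc, div_mul_cancel₀ _ two_ne_zero]
  exact skiALG_le_mul_min (Nat.zero_lt_of_lt hp) hb x
end

section
/- In the ski-rental problem, if 1 ≤ b < p then the competitive ratio of A(b) is exactly (b + p)/(b + 1), which is strictly less than 1 + p/b: for every integer x ≥ 1 one has ALG_b(x) ≤ ((b + p)/(b + 1)) · min(x, p), equality holds for x = b + 1, and (b + p)/(b + 1) < 1 + p/b. -/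
/-- If `1 ≤ b < p`, the competitive ratio of `A(b)` is exactly `(b + p)/(b + 1)`,
attained at `x = b + 1`, and this ratio is strictly less than `1 + p/b`. -/
theorem ski_rental_cr_b_lt_p (p b : ℕ) (hp : 1 < p) (hb : 1 ≤ b) (hbp : b < p) :
    (∀ x : ℕ, 1 ≤ x →
      skiALG b p x ≤ (((b : ℝ) + (p : ℝ)) / ((b : ℝ) + 1)) * min (x : ℝ) (p : ℝ)) ∧
    skiALG b p (b + 1) = (((b : ℝ) + (p : ℝ)) / ((b : ℝ) + 1)) * min ((b : ℝ) + 1) (p : ℝ) ∧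
    ((b : ℝ) + (p : ℝ)) / ((b : ℝ) + 1) < 1 + (p : ℝ) / (b : ℝ) := by
  have hb' : (1 : ℝ) ≤ b := by exact_mod_cast hb
  have hbp' : (b : ℝ) + 1 ≤ p := by exact_mod_cast hbp
  have hratio : (1 : ℝ) ≤ ((b : ℝ) + p) / (b + 1) := by
    rw [one_le_div (by linarith)]
    linarith
  have hcancel : ((b : ℝ) + p) / (b + 1) * (b + 1) = b + p :=
    div_mul_cancel₀ _ (by linarith)
  refine ⟨fun x _ => ?_, ?_, ?_⟩
  · unfold skiALG
    split_ifs with hx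
    · have hx' : (x : ℝ) ≤ b := by exact_mod_cast hx
      rw [min_eq_left (by linarith)]
      exact le_mul_of_one_le_left x.cast_nonneg hratio
    · have hx' : (b : ℝ) + 1 ≤ x := by exact_mod_cast not_le.mp hx
      calc (b : ℝ) + p = (b + p) / (b + 1) * (b + 1) := hcancel.symm
        _ ≤ (b + p) / (b + 1) * min (x : ℝ) p :=
          mul_le_mul_of_nonneg_left (le_min hx' hbp') (by linarith)
  · rw [min_eq_left hbp', hcancel, skiALG, if_neg (by omega)]
  · calc ((b : ℝ) + p) / (b + 1) < (b + p) / b :=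
          div_lt_div_of_pos_left (by linarith) (by linarith) (by linarith)
      _ = 1 + p / b := by rw [add_div, div_self (by linarith)]
end

section
/- For every α ≥ 1, the utilization level z^u := T(1 + ln(γ)/α) satisfies T < z^u ≤ 1, the threshold function attains the maximum value density at z^u, i.e., Ψ_α(z^u) = U, and Ψ_α(z) < U for every z < z^u. -/
/-- The parametric threshold function `Psi α` for the online knapsack problem:
`Psi α z = L` for `z < T` and `Psi α z = min U (L * exp (α * (z/T - 1)))` for `z ≥ T`. -/
noncomputable def Psi (L U T α z : ℝ) : ℝ :=
  if z < T then L else min U (L * Real.exp (α * (z / T - 1)))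

/-- For `α ≥ 1`, the utilization level `z^u := T * (1 + log γ / α)` satisfies
`T < z^u ≤ 1`, the threshold attains the maximum value density there,
i.e. `Psi z^u = U`, and `Psi z < U` for every `z < z^u`. -/
theorem Psi_reaches_U_at_zu (L U γ T α : ℝ) (hL : 0 < L) (hLU : L < U)
    (hγ : γ = U / L) (hT : T = 1 / (Real.log γ + 1)) (hα : 1 ≤ α) :
    (T < T * (1 + Real.log γ / α) ∧ T * (1 + Real.log γ / α) ≤ 1) ∧
    Psi L U T α (T * (1 + Real.log γ / α)) = U ∧
    (∀ z : ℝ, z < T * (1 + Real.log γ / α) → Psi L U T α z < U) := by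
  have hγ1 : 1 < γ := by rw [hγ]; exact (one_lt_div hL).2 hLU
  have hlog : 0 < Real.log γ := Real.log_pos hγ1
  have hα0 : 0 < α := by linarith
  have hT0 : 0 < T := by rw [hT]; positivity
  have hU : L * Real.exp (Real.log γ) = U := by
    rw [Real.exp_log (by linarith), hγ, mul_div_cancel₀ U hL.ne']
  have hlt : T < T * (1 + Real.log γ / α) :=
    lt_mul_of_one_lt_right hT0 (lt_add_of_pos_right 1 (div_pos hlog hα0))
  refine ⟨⟨hlt, ?_⟩, ?_, fun z hz => ?_⟩
  · calc T * (1 + Real.log γ / α) ≤ T * (1 + Real.log γ) := by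
          gcongr
          exact div_le_self hlog.le hα
      _ = 1 := by rw [hT]; field_simp; ring
  · have harg : α * (T * (1 + Real.log γ / α) / T - 1) = Real.log γ := by
      field_simp
      ring
    rw [Psi, if_neg hlt.not_gt, harg, hU, min_self]
  · unfold Psi
    split_ifs
    · exact hLU
    · have hzT : z / T < 1 + Real.log γ / α := (div_lt_iff₀' hT0).2 hz
      have harg : α * (z / T - 1) < Real.log γ :=
        (lt_div_iff₀' hα0).1 (by linarith)
      refine (min_le_right _ _).trans_lt ?_
      calc L * Real.exp (α * (z / T - 1)) < L * Real.exp (Real.log γ) := by gcongr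
        _ = U := hU
end

section
/- For every α with 0 < α < 1, the threshold function never reaches the maximum value density within the knapsack capacity: Ψ_α(z) < U for all z ≤ 1; moreover ∫₀^1 Ψ_α(u) du = L·T·(α + γ^α − 1)/α. -/
theorem Psi_eq_of_le {L U T α z : ℝ} (hT : 0 < T) (hLU : L ≤ U) (hz : z ≤ T) :
    Psi L U T α z = L := by
  rcases hz.lt_or_eq with h | rfl
  · simp [Psi, h]
  · simp [Psi, div_self hT.ne', hLU]

theorem Psi_eq_exp_of_le {L U T α z : ℝ} (hz : T ≤ z)
    (hU : L * Real.exp (α * (z / T - 1)) ≤ U) :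
    Psi L U T α z = L * Real.exp (α * (z / T - 1)) := by
  simp [Psi, hz.not_gt, hU]

theorem integral_exp_threshold {L T α : ℝ} (hT : T ≠ 0) (hα : α ≠ 0) (a b : ℝ) :
    ∫ u in a..b, L * Real.exp (α * (u / T - 1)) =
      L * T / α * Real.exp (α * (b / T - 1)) - L * T / α * Real.exp (α * (a / T - 1)) := by
  refine intervalIntegral.integral_eq_sub_of_hasDerivAt
    (f := fun u => L * T / α * Real.exp (α * (u / T - 1))) (fun u _ => ?_)
    (Continuous.intervalIntegrable (by fun_prop) _ _)
  have h := (((((hasDerivAt_id u).div_const T).sub_const 1).const_mul α).exp).const_mul (L * T / α)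
  refine h.congr_deriv ?_
  simp only [id]
  field_simp

/-- For `0 < α < 1`, the threshold never reaches the maximum value density
within the knapsack capacity: `Psi z < U` for all `z ≤ 1`; moreover
`∫ u in 0..1, Psi u = L * T * (α + γ^α - 1) / α` (real power). -/
theorem Psi_below_U_and_integral (L U γ T α : ℝ) (hL : 0 < L) (hLU : L < U)
    (hγ : γ = U / L) (hT : T = 1 / (Real.log γ + 1)) (hα1 : 0 < α) (hα2 : α < 1) :
    (∀ z : ℝ, z ≤ 1 → Psi L U T α z < U) ∧
    ∫ u in (0:ℝ)..1, Psi L U T α u = L * T * (α + γ ^ α - 1) / α := by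
  have hγ1 : 1 < γ := by rw [hγ, lt_div_iff₀ hL]; linarith
  have hlog : 0 < Real.log γ := Real.log_pos hγ1
  have hT0 : 0 < T := by rw [hT]; positivity
  have hT1 : T ≤ 1 := by rw [hT, div_le_one (by positivity)]; linarith
  have hTinv : 1 / T - 1 = Real.log γ := by rw [hT]; simp
  have hlt : ∀ z ≤ 1, L * Real.exp (α * (z / T - 1)) < U := by
    intro z hz
    have h1 : z / T - 1 ≤ Real.log γ := by rw [← hTinv]; gcongr
    have h2 : α * (z / T - 1) < Real.log γ := by nlinarith
    have h3 := Real.exp_lt_exp.2 h2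
    rwa [Real.exp_log (by linarith), hγ, lt_div_iff₀' hL] at h3
  have hleft : Set.EqOn (Psi L U T α) (fun _ => L) (Set.uIcc 0 T) := fun z hz =>
    Psi_eq_of_le hT0 hLU.le (Set.uIcc_of_le hT0.le ▸ hz).2
  have hright : Set.EqOn (Psi L U T α) (fun z => L * Real.exp (α * (z / T - 1)))
      (Set.uIcc T 1) := fun z hz => by
    rw [Set.uIcc_of_le hT1] at hz
    exact Psi_eq_exp_of_le hz.1 (hlt z hz.2).le
  refine ⟨fun z hz => ?_, ?_⟩
  · rcases le_total z T with h | h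
    · rwa [Psi_eq_of_le hT0 hLU.le h]
    · rw [Psi_eq_exp_of_le h (hlt z hz).le]
      exact hlt z hz
  · rw [← intervalIntegral.integral_add_adjacent_intervals (b := T)
        (continuousOn_const.congr hleft).intervalIntegrable
        (ContinuousOn.congr (by fun_prop) hright).intervalIntegrable,
      intervalIntegral.integral_congr hleft, intervalIntegral.integral_congr hright,
      integral_exp_threshold hT0.ne' hα1.ne', hTinv, div_self hT0.ne',
      Real.rpow_def_of_pos (by linarith), mul_comm (Real.log γ)]
    simp only [intervalIntegral.integral_const, smul_eq_mul, sub_self, mul_zero, Real.exp_zero]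
    field_simp
    ring
end

section
/- The worst-case optimized threshold algorithm OKP-Alg(1) is (ln γ + 1)-competitive with the bound tight at every utilization level above T: for every z with T ≤ z ≤ 1, Ψ_1(z) = (ln γ + 1) · ∫₀^z Ψ_1(u) du. -/
/-- At `α = 1` the cap `U` is inactive on `[T, 1]`. -/
theorem Psi_one_of_ge {L U T u : ℝ} (hL : 0 < L) (hLU : L < U)
    (hT : T = 1 / (Real.log (U / L) + 1)) (hTu : T ≤ u) (hu : u ≤ 1) :
    Psi L U T 1 u = L * Real.exp (u / T - 1) := by
  have hlog : 0 < Real.log (U / L) := Real.log_pos ((one_lt_div hL).2 hLU)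
  have hexp : u / T - 1 ≤ Real.log (U / L) := by
    rw [hT, one_div, div_inv_eq_mul]
    nlinarith
  have hcap : L * Real.exp (u / T - 1) ≤ U := by
    calc L * Real.exp (u / T - 1) ≤ L * Real.exp (Real.log (U / L)) := by gcongr
      _ = U := by
        rw [Real.exp_log (div_pos (hL.trans hLU) hL)]
        field_simp
  rw [Psi, if_neg hTu.not_gt, one_mul, min_eq_right hcap]

theorem integral_mul_exp_div_sub_one (L : ℝ) {T : ℝ} (hT : T ≠ 0) (z : ℝ) :
    ∫ u in T..z, L * Real.exp (u / T - 1) = L * T * (Real.exp (z / T - 1) - 1) := by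
  have hderiv : ∀ u ∈ Set.uIcc T z,
      HasDerivAt (fun u => L * T * Real.exp (u / T - 1)) (L * Real.exp (u / T - 1)) u := by
    intro u _
    refine ((((hasDerivAt_id' u).div_const T).sub_const 1).exp.const_mul (L * T)).congr_deriv ?_
    field_simp
  rw [intervalIntegral.integral_eq_sub_of_hasDerivAt hderiv
    (Continuous.intervalIntegrable (by fun_prop) _ _)]
  simp only [div_self hT, sub_self, Real.exp_zero]
  ring

/-- The worst-case optimized algorithm `OKP-Alg(1)` is `(log γ + 1)`-competitive,
with the bound tight at every utilization level above `T`: for every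
`T ≤ z ≤ 1`, `Psi 1 z = (log γ + 1) * ∫ u in 0..z, Psi 1 u`. -/
theorem OKPAlg_one_tight (L U γ T : ℝ) (hL : 0 < L) (hLU : L < U)
    (hγ : γ = U / L) (hT : T = 1 / (Real.log γ + 1)) (z : ℝ)
    (hz1 : T ≤ z) (hz2 : z ≤ 1) :
    Psi L U T 1 z = (Real.log γ + 1) * ∫ u in (0:ℝ)..z, Psi L U T 1 u := by
  subst hγ
  have hlog : 0 < Real.log (U / L) := Real.log_pos ((one_lt_div hL).2 hLU)
  have hT0 : 0 < T := by rw [hT]; positivity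
  have hT' : Real.log (U / L) + 1 = T⁻¹ := by rw [hT, one_div, inv_inv]
  have hlow : Set.EqOn (fun _ => L) (Psi L U T 1) (Set.uIoo 0 T) := by
    intro u hu
    rw [Set.uIoo_of_le hT0.le] at hu
    simp [Psi, hu.2]
  have hhigh : Set.EqOn (fun u => L * Real.exp (u / T - 1)) (Psi L U T 1) (Set.uIoo T z) := by
    intro u hu
    rw [Set.uIoo_of_le hz1] at hu
    exact (Psi_one_of_ge hL hLU hT hu.1.le (hu.2.le.trans hz2)).symm
  have hint_low : IntervalIntegrable (Psi L U T 1) MeasureTheory.volume 0 T :=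
    (continuous_const.intervalIntegrable 0 T).congr_uIoo hlow
  have hint_high : IntervalIntegrable (Psi L U T 1) MeasureTheory.volume T z :=
    (Continuous.intervalIntegrable (by fun_prop) T z).congr_uIoo hhigh
  rw [← intervalIntegral.integral_add_adjacent_intervals hint_low hint_high,
    ← intervalIntegral.integral_congr_uIoo hlow, ← intervalIntegral.integral_congr_uIoo hhigh,
    integral_mul_exp_div_sub_one L hT0.ne', Psi_one_of_ge hL hLU hT hz1 hz2, hT',
    intervalIntegral.integral_const, smul_eq_mul]
  field_simp
  ring
end

section
/- (Degradation factor of OKP-Alg(α), case α ≥ 1.) For every α ≥ 1 and every z with T < z ≤ 1, T · Ψ_α(z) ≤ (αγ/(α + γ − 1)) · ∫₀^z Ψ_α(u) du; that is, the worst-case ratio Ψ_α(z)/∫₀^z Ψ_α(u)du is at most (αγ/(α + γ − 1))·(ln γ + 1), so the competitive ratio of OKP-Alg(α) exceeds that of OKP-Alg(1) by the factor at most αγ/(α + γ − 1). -/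
theorem Psi_mono {L U T α : ℝ} (hL : 0 < L) (hLU : L < U) (hT : 0 < T) (hα : 0 ≤ α) :
    Monotone (Psi L U T α) := by
  intro x y hxy
  unfold Psi
  split_ifs with hx hy hy
  · exact le_rfl
  · have h1 : 1 ≤ y / T := by rw [one_le_div hT]; linarith
    have h2 : 1 ≤ Real.exp (α * (y / T - 1)) :=
      Real.one_le_exp (mul_nonneg hα (by linarith))
    exact le_min hLU.le (by nlinarith)
  · linarith
  · gcongr

theorem le_Psi {L U T α : ℝ} (hL : 0 < L) (hLU : L < U) (hT : 0 < T) (hα : 0 ≤ α) (u : ℝ) :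
    L ≤ Psi L U T α u := by
  rcases lt_or_ge u T with h | h
  · simp [Psi, h]
  · calc L = Psi L U T α T := by simp [Psi, hT.ne', hLU.le]
      _ ≤ Psi L U T α u := Psi_mono hL hLU hT hα h

theorem integral_mul_exp_threshold {L T α : ℝ} (hT : T ≠ 0) (hα : α ≠ 0) (w : ℝ) :
    ∫ u in T..w, L * Real.exp (α * (u / T - 1)) =
      T * L * (Real.exp (α * (w / T - 1)) - 1) / α := by
  have hd : ∀ u ∈ Set.uIcc T w,
      HasDerivAt (fun u ↦ T * L / α * Real.exp (α * (u / T - 1)))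
        (L * Real.exp (α * (u / T - 1))) u := by
    intro u _
    have h := ((((((hasDerivAt_id u).div_const T).sub_const 1).const_mul α).exp).const_mul
      (T * L / α))
    refine h.congr_deriv ?_
    simp only [id_eq]
    field_simp
  rw [intervalIntegral.integral_eq_sub_of_hasDerivAt hd
    (Continuous.intervalIntegrable (by fun_prop) _ _), div_self hT]
  simp
  ring

/-- As long as the exponential part of the threshold is not capped by `U` on `[T, w]`, the
integral over any longer interval is at least the integral of the uncapped threshold. -/
theorem le_integral_Psi {L U T α w z : ℝ} (hL : 0 < L) (hLU : L < U) (hT : 0 < T) (hα : 0 < α)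
    (hTw : T ≤ w) (hwz : w ≤ z) (hw : L * Real.exp (α * (w / T - 1)) ≤ U) :
    T * L * (α + Real.exp (α * (w / T - 1)) - 1) / α ≤ ∫ u in (0:ℝ)..z, Psi L U T α u := by
  have hint : ∀ a b : ℝ, IntervalIntegrable (Psi L U T α) MeasureTheory.volume a b :=
    fun a b ↦ (Psi_mono hL hLU hT hα.le).intervalIntegrable
  have h1 : T * L ≤ ∫ u in (0:ℝ)..T, Psi L U T α u := by
    have := intervalIntegral.integral_mono_on hT.le
      (intervalIntegrable_const (c := L)) (hint 0 T) (fun u _ ↦ le_Psi hL hLU hT hα.le u)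
    simpa using this
  have h2 : ∫ u in T..w, Psi L U T α u =
      T * L * (Real.exp (α * (w / T - 1)) - 1) / α := by
    rw [← integral_mul_exp_threshold hT.ne' hα.ne']
    refine intervalIntegral.integral_congr fun u hu ↦ ?_
    rw [Set.uIcc_of_le hTw] at hu
    have hle : L * Real.exp (α * (u / T - 1)) ≤ L * Real.exp (α * (w / T - 1)) := by
      have := hu.2
      gcongr
    simp only [Psi, not_lt.mpr hu.1, if_false]
    exact min_eq_right (hle.trans hw)
  have h3 : 0 ≤ ∫ u in w..z, Psi L U T α u :=
    intervalIntegral.integral_nonneg hwz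
      fun u _ ↦ hL.le.trans (le_Psi hL hLU hT hα.le u)
  rw [← intervalIntegral.integral_add_adjacent_intervals (hint 0 w) (hint w z),
    ← intervalIntegral.integral_add_adjacent_intervals (hint 0 T) (hint T w), h2]
  have h4 : T * L * (α + Real.exp (α * (w / T - 1)) - 1) / α =
      T * L + T * L * (Real.exp (α * (w / T - 1)) - 1) / α := by
    field_simp
    ring
  linarith

/-- Beyond `T`, every value of the threshold is attained where the exponential part is not yet
capped. -/
theorem exists_Psi_eq_mul_exp {L U T α z : ℝ} (hLU : L < U) (hT : 0 < T) (hz : T ≤ z) :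
    ∃ w, T ≤ w ∧ w ≤ z ∧ Psi L U T α z = L * Real.exp (α * (w / T - 1)) := by
  have hPsi : Psi L U T α z = min U (L * Real.exp (α * (z / T - 1))) := by
    simp [Psi, not_lt.mpr hz]
  rcases le_total (L * Real.exp (α * (z / T - 1))) U with h | h
  · exact ⟨z, hz, le_rfl, by rw [hPsi, min_eq_right h]⟩
  · have hcont : ContinuousOn (fun w ↦ L * Real.exp (α * (w / T - 1))) (Set.Icc T z) := by
      fun_prop
    obtain ⟨w, hw, hwU⟩ := intermediate_value_Icc hz hcont
      (show U ∈ _ from ⟨by simpa [hT.ne'] using hLU.le, h⟩)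
    exact ⟨w, hw.1, hw.2, by rw [hPsi, min_eq_left h]; exact hwU.symm⟩

/-- Degradation factor of `OKP-Alg(α)` for `α ≥ 1`: for every `T < z ≤ 1`,
`T * Psi α z ≤ (α*γ/(α + γ - 1)) * ∫ u in 0..z, Psi α u`. -/
theorem OKP_degradation_factor_alpha_ge_one (L U γ T α z : ℝ) (hL : 0 < L) (hLU : L < U)
    (hγ : γ = U / L) (hT : T = 1 / (Real.log γ + 1)) (hα : 1 ≤ α)
    (hz1 : T < z) (hz2 : z ≤ 1) :
    T * Psi L U T α z ≤ (α * γ / (α + γ - 1)) * ∫ u in (0:ℝ)..z, Psi L U T α u := by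
  have hγ1 : 1 < γ := by rw [hγ, one_lt_div hL]; exact hLU
  have hT0 : 0 < T := by
    have := Real.log_pos hγ1
    rw [hT]
    positivity
  have hα0 : 0 < α := by linarith
  obtain ⟨w, hTw, hwz, hw⟩ := exists_Psi_eq_mul_exp (α := α) hLU hT0 hz1.le
  have hwU : L * Real.exp (α * (w / T - 1)) ≤ U := by
    rw [← hw]
    simp [Psi, not_lt.mpr hz1.le]
  have hint := le_integral_Psi hL hLU hT0 hα0 hTw hwz hwU
  rw [hw]
  set E := Real.exp (α * (w / T - 1))
  have hEγ : E ≤ γ := by rw [hγ, le_div_iff₀ hL]; linarith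
  have hden : 0 < α + γ - 1 := by linarith
  have hfac : 0 ≤ α * γ / (α + γ - 1) := by positivity
  refine le_trans ?_ (mul_le_mul_of_nonneg_left hint hfac)
  have hkey : E * (α + γ - 1) ≤ γ * (α + E - 1) := by
    nlinarith [mul_nonneg (sub_nonneg.mpr hα) (sub_nonneg.mpr hEγ)]
  calc T * (L * E) = T * L * (E * (α + γ - 1)) / (α + γ - 1) := by field_simp
    _ ≤ T * L * (γ * (α + E - 1)) / (α + γ - 1) := by gcongr
    _ = α * γ / (α + γ - 1) * (T * L * (α + E - 1) / α) := by field_simp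
end
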